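/- arXiv:2509.20764 — 8 statements merged into one kernel-verified Lean document; each statement's English description precedes it below -/
import Mathlib

section
/- Let g, ω ∈ ℝ and let b : ℝ² → ℝ be continuously differentiable. Suppose h, u, v, q, r : ℝ × ℝ² → ℝ are continuously differentiable and satisfy the modified rotating shallow water system ∂t h + ∂x(h u − q) + ∂y(h v − r) = 0, ∂t(h u) + ∂x((h u − q) u) + ∂y((h v − r) u) + h ∂x φ = ω (h v − r), ∂t(h v) + ∂x((h u − q) v) + ∂y((h v − r) v) + h ∂y φ = −ω (h u − q), where φ = g(h + b). Then the total energy E = ½ g h² + g b h + ½ h (u² + v²) satisfies, pointwise, ∂t E + ∂x((φ + (u² + v²)/2)(h u − q)) + ∂y((φ + (u² + v²)/2)(h v − r)) = −q (∂x φ − ω v) − r (∂y φ + ω u). -/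
/-- Partial derivative in time of a function of `(t, x, y)`. -/
noncomputable def pt (f : ℝ → ℝ → ℝ → ℝ) (t x y : ℝ) : ℝ :=
  deriv (fun s => f s x y) t

/-- Partial derivative in `x` of a function of `(t, x, y)`. -/
noncomputable def px (f : ℝ → ℝ → ℝ → ℝ) (t x y : ℝ) : ℝ :=
  deriv (fun s => f t s y) x

/-- Partial derivative in `y` of a function of `(t, x, y)`. -/
noncomputable def py (f : ℝ → ℝ → ℝ → ℝ) (t x y : ℝ) : ℝ :=
  deriv (fun s => f t x s) y

/-- A jointly `C¹` function of `(t, x, y)` has derivative `pt`, `px`, `py` along each axis. -/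
theorem hasDerivAt_partials {f : ℝ → ℝ → ℝ → ℝ}
    (hf : ContDiff ℝ 1 (fun p : ℝ × ℝ × ℝ => f p.1 p.2.1 p.2.2)) (t x y : ℝ) :
    HasDerivAt (fun s => f s x y) (pt f t x y) t ∧
      HasDerivAt (fun s => f t s y) (px f t x y) x ∧
      HasDerivAt (fun s => f t x s) (py f t x y) y := by
  have hd := hf.differentiable one_ne_zero
  refine ⟨DifferentiableAt.hasDerivAt ?_, DifferentiableAt.hasDerivAt ?_,
    DifferentiableAt.hasDerivAt ?_⟩
  · exact (hd (t, x, y)).comp t (f := fun s : ℝ => (s, x, y)) (by fun_prop)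
  · exact (hd (t, x, y)).comp x (f := fun s : ℝ => (t, s, y)) (by fun_prop)
  · exact (hd (t, x, y)).comp y (f := fun s : ℝ => (t, x, s)) (by fun_prop)

/-- Derivative of the energy density along a direction in which the bottom is constant. -/
theorem hasDerivAt_energy {h u v : ℝ → ℝ} {h' u' v' s : ℝ} (g b : ℝ)
    (hh : HasDerivAt h h' s) (hu : HasDerivAt u u' s) (hv : HasDerivAt v v' s) :
    HasDerivAt
      (fun s => (1/2) * g * h s ^ 2 + g * b * h s + (1/2) * h s * (u s ^ 2 + v s ^ 2))
      ((g * (h s + b) + (u s ^ 2 + v s ^ 2) / 2) * h' + h s * (u s * u' + v s * v')) s := by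
  refine ((((hh.fun_pow 2).const_mul ((1/2) * g)).fun_add (hh.const_mul (g * b))).fun_add
    ((hh.const_mul (1/2)).fun_mul ((hu.fun_pow 2).fun_add (hv.fun_pow 2)))).congr_deriv ?_
  ring

/-- Derivative of the Bernoulli flux `(φ + (u² + v²) / 2) m`. -/
theorem hasDerivAt_bernoulli_flux {φ u v m : ℝ → ℝ} {φ' u' v' m' s : ℝ}
    (hφ : HasDerivAt φ φ' s) (hu : HasDerivAt u u' s) (hv : HasDerivAt v v' s)
    (hm : HasDerivAt m m' s) :
    HasDerivAt (fun s => (φ s + (u s ^ 2 + v s ^ 2) / 2) * m s)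
      ((φ' + (u s * u' + v s * v')) * m s + (φ s + (u s ^ 2 + v s ^ 2) / 2) * m') s := by
  refine ((hφ.fun_add (((hu.fun_pow 2).fun_add (hv.fun_pow 2)).div_const 2)).fun_mul
    hm).congr_deriv ?_
  ring

/-- Energy identity for smooth solutions of the modified (stabilised)
rotating shallow water system with generic perturbations `q`, `r`. -/
theorem stmt_1 (g ω : ℝ) (b : ℝ → ℝ → ℝ)
    (hb : ContDiff ℝ 1 (fun p : ℝ × ℝ => b p.1 p.2))
    (h u v q r : ℝ → ℝ → ℝ → ℝ)
    (hh : ContDiff ℝ 1 (fun p : ℝ × ℝ × ℝ => h p.1 p.2.1 p.2.2))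
    (hu : ContDiff ℝ 1 (fun p : ℝ × ℝ × ℝ => u p.1 p.2.1 p.2.2))
    (hv : ContDiff ℝ 1 (fun p : ℝ × ℝ × ℝ => v p.1 p.2.1 p.2.2))
    (hq : ContDiff ℝ 1 (fun p : ℝ × ℝ × ℝ => q p.1 p.2.1 p.2.2))
    (hr : ContDiff ℝ 1 (fun p : ℝ × ℝ × ℝ => r p.1 p.2.1 p.2.2))
    (φ : ℝ → ℝ → ℝ → ℝ)
    (hφ : φ = fun t x y => g * (h t x y + b x y))
    (mass : ∀ t x y,
      pt h t x y
      + px (fun t x y => h t x y * u t x y - q t x y) t x y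
      + py (fun t x y => h t x y * v t x y - r t x y) t x y = 0)
    (momx : ∀ t x y,
      pt (fun t x y => h t x y * u t x y) t x y
      + px (fun t x y => (h t x y * u t x y - q t x y) * u t x y) t x y
      + py (fun t x y => (h t x y * v t x y - r t x y) * u t x y) t x y
      + h t x y * px φ t x y = ω * (h t x y * v t x y - r t x y))
    (momy : ∀ t x y,
      pt (fun t x y => h t x y * v t x y) t x y
      + px (fun t x y => (h t x y * u t x y - q t x y) * v t x y) t x y
      + py (fun t x y => (h t x y * v t x y - r t x y) * v t x y) t x y
      + h t x y * py φ t x y = -(ω * (h t x y * u t x y - q t x y)))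
    (E : ℝ → ℝ → ℝ → ℝ)
    (hE : E = fun t x y =>
      (1/2) * g * h t x y ^ 2 + g * b x y * h t x y
      + (1/2) * h t x y * (u t x y ^ 2 + v t x y ^ 2)) :
    ∀ t x y,
      pt E t x y
      + px (fun t x y =>
          (φ t x y + (u t x y ^ 2 + v t x y ^ 2) / 2)
            * (h t x y * u t x y - q t x y)) t x y
      + py (fun t x y =>
          (φ t x y + (u t x y ^ 2 + v t x y ^ 2) / 2)
            * (h t x y * v t x y - r t x y)) t x y
      = - q t x y * (px φ t x y - ω * v t x y)
        - r t x y * (py φ t x y + ω * u t x y) := by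
  intro t x y
  have hb₃ : ContDiff ℝ 1 (fun p : ℝ × ℝ × ℝ => b p.2.1 p.2.2) := hb.comp contDiff_snd
  have hφ₁ : ContDiff ℝ 1 (fun p : ℝ × ℝ × ℝ => φ p.1 p.2.1 p.2.2) := by
    subst hφ
    exact contDiff_const.mul (hh.add hb₃)
  obtain ⟨ht, -, -⟩ := hasDerivAt_partials hh t x y
  obtain ⟨ut, ux, uy⟩ := hasDerivAt_partials hu t x y
  obtain ⟨vt, vx, vy⟩ := hasDerivAt_partials hv t x y
  obtain ⟨-, φx, φy⟩ := hasDerivAt_partials hφ₁ t x y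
  obtain ⟨-, mx, -⟩ := hasDerivAt_partials
    (f := fun t x y => h t x y * u t x y - q t x y) ((hh.mul hu).sub hq) t x y
  obtain ⟨-, -, ny⟩ := hasDerivAt_partials
    (f := fun t x y => h t x y * v t x y - r t x y) ((hh.mul hv).sub hr) t x y
  subst hE
  have energy : pt (fun t x y => (1/2) * g * h t x y ^ 2 + g * b x y * h t x y
      + (1/2) * h t x y * (u t x y ^ 2 + v t x y ^ 2)) t x y = _ :=
    (hasDerivAt_energy g (b x y) ht ut vt).deriv
  have fluxx : px (fun t x y => (φ t x y + (u t x y ^ 2 + v t x y ^ 2) / 2)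
      * (h t x y * u t x y - q t x y)) t x y = _ :=
    (hasDerivAt_bernoulli_flux φx ux vx mx).deriv
  have fluxy : py (fun t x y => (φ t x y + (u t x y ^ 2 + v t x y ^ 2) / 2)
      * (h t x y * v t x y - r t x y)) t x y = _ :=
    (hasDerivAt_bernoulli_flux φy uy vy ny).deriv
  have hut : pt (fun t x y => h t x y * u t x y) t x y = _ := (ht.fun_mul ut).deriv
  have hvt : pt (fun t x y => h t x y * v t x y) t x y = _ := (ht.fun_mul vt).deriv
  have mux : px (fun t x y => (h t x y * u t x y - q t x y) * u t x y) t x y = _ :=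
    (mx.fun_mul ux).deriv
  have mvx : px (fun t x y => (h t x y * u t x y - q t x y) * v t x y) t x y = _ :=
    (mx.fun_mul vx).deriv
  have nuy : py (fun t x y => (h t x y * v t x y - r t x y) * u t x y) t x y = _ :=
    (ny.fun_mul uy).deriv
  have nvy : py (fun t x y => (h t x y * v t x y - r t x y) * v t x y) t x y = _ :=
    (ny.fun_mul vy).deriv
  have hmass := mass t x y
  have hmomx := momx t x y
  have hmomy := momy t x y
  rw [hut, mux, nuy] at hmomx
  rw [hvt, mvx, nvy] at hmomy
  have hφt : φ t x y = g * (h t x y + b x y) := by rw [hφ]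
  rw [energy, fluxx, fluxy, ← hφt]
  linear_combination u t x y * hmomx + v t x y * hmomy
    + (φ t x y - (u t x y ^ 2 + v t x y ^ 2) / 2) * hmass
end

section
/- Let g, ω ∈ ℝ, η > 0, ξ > 0, and let b : ℝ² → ℝ be twice continuously differentiable. Suppose h, u, v : ℝ × ℝ² → ℝ are twice continuously differentiable and, setting φ = g(h + b), q = η (∂x φ − ω v) and r = ξ (∂y φ + ω u), they satisfy the modified rotating shallow water system ∂t h + ∂x(h u − q) + ∂y(h v − r) = 0, ∂t(h u) + ∂x((h u − q) u) + ∂y((h v − r) u) + h ∂x φ = ω (h v − r), ∂t(h v) + ∂x((h u − q) v) + ∂y((h v − r) v) + h ∂y φ = −ω (h u − q). Then, pointwise, ∂t E + ∂x((φ + (u² + v²)/2)(h u − q)) + ∂y((φ + (u² + v²)/2)(h v − r)) = −η (∂x φ − ω v)² − ξ (∂y φ + ω u)² ≤ 0, where E = ½ g h² + g b h + ½ h (u² + v²). -/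
section Slices

variable {f : ℝ → ℝ → ℝ → ℝ} {n : WithTop ℕ∞}

theorem ContDiff.slice_t (hf : ContDiff ℝ n (fun p : ℝ × ℝ × ℝ => f p.1 p.2.1 p.2.2))
    (x y : ℝ) : ContDiff ℝ n (fun s => f s x y) :=
  hf.comp (g := fun p : ℝ × ℝ × ℝ => f p.1 p.2.1 p.2.2) (f := fun s : ℝ => (s, x, y))
    (by fun_prop)

theorem ContDiff.slice_x (hf : ContDiff ℝ n (fun p : ℝ × ℝ × ℝ => f p.1 p.2.1 p.2.2))
    (t y : ℝ) : ContDiff ℝ n (fun s => f t s y) :=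
  hf.comp (g := fun p : ℝ × ℝ × ℝ => f p.1 p.2.1 p.2.2) (f := fun s : ℝ => (t, s, y))
    (by fun_prop)

theorem ContDiff.slice_y (hf : ContDiff ℝ n (fun p : ℝ × ℝ × ℝ => f p.1 p.2.1 p.2.2))
    (t x : ℝ) : ContDiff ℝ n (fun s => f t x s) :=
  hf.comp (g := fun p : ℝ × ℝ × ℝ => f p.1 p.2.1 p.2.2) (f := fun s : ℝ => (t, x, s))
    (by fun_prop)

theorem differentiable_px_slice
    (hf : ContDiff ℝ 2 (fun p : ℝ × ℝ × ℝ => f p.1 p.2.1 p.2.2)) (t y : ℝ) :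
    Differentiable ℝ (fun s => px f t s y) :=
  (hf.slice_x t y).differentiable_deriv_two

theorem differentiable_py_slice
    (hf : ContDiff ℝ 2 (fun p : ℝ × ℝ × ℝ => f p.1 p.2.1 p.2.2)) (t x : ℝ) :
    Differentiable ℝ (fun s => py f t x s) :=
  (hf.slice_y t x).differentiable_deriv_two

end Slices

/-- Derivative of the kinetic-plus-potential energy flux `(φ + (u² + v²)/2) m`. -/
theorem deriv_energy_flux {φ u v m : ℝ → ℝ} {s : ℝ} (hφ : DifferentiableAt ℝ φ s)
    (hu : DifferentiableAt ℝ u s) (hv : DifferentiableAt ℝ v s)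
    (hm : DifferentiableAt ℝ m s) :
    deriv (fun s => (φ s + (u s ^ 2 + v s ^ 2) / 2) * m s) s
      = (deriv φ s + u s * deriv u s + v s * deriv v s) * m s
        + (φ s + (u s ^ 2 + v s ^ 2) / 2) * deriv m s := by
  have H := (hφ.hasDerivAt.add (((hu.hasDerivAt.pow 2).add
    (hv.hasDerivAt.pow 2)).div_const 2)).mul hm.hasDerivAt
  refine H.deriv.trans ?_
  simp only [Pi.add_apply, Pi.pow_apply]
  push_cast
  ring

/-- Time derivative of the total energy over a fixed bottom height `b`. -/
theorem deriv_energy (g b : ℝ) {h u v : ℝ → ℝ} {s : ℝ} (hh : DifferentiableAt ℝ h s)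
    (hu : DifferentiableAt ℝ u s) (hv : DifferentiableAt ℝ v s) :
    deriv (fun s => (1/2) * g * h s ^ 2 + g * b * h s
        + (1/2) * h s * (u s ^ 2 + v s ^ 2)) s
      = (g * (h s + b) + (u s ^ 2 + v s ^ 2) / 2) * deriv h s
        + h s * (u s * deriv u s + v s * deriv v s) := by
  have H := (((hh.hasDerivAt.pow 2).const_mul ((1/2) * g)).add
    (hh.hasDerivAt.const_mul (g * b))).add
    ((hh.hasDerivAt.const_mul (1/2)).mul ((hu.hasDerivAt.pow 2).add (hv.hasDerivAt.pow 2)))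
  refine H.deriv.trans ?_
  simp only [Pi.add_apply, Pi.pow_apply]
  push_cast
  ring

/-- Energy dissipation for smooth solutions of the modified rotating shallow
water system with the stabilisation choices `q = η(∂x φ − ω v)`,
`r = ξ(∂y φ + ω u)`, `η, ξ > 0`. -/
theorem stmt_2 (g ω η ξ : ℝ) (hη : 0 < η) (hξ : 0 < ξ) (b : ℝ → ℝ → ℝ)
    (hb : ContDiff ℝ 2 (fun p : ℝ × ℝ => b p.1 p.2))
    (h u v : ℝ → ℝ → ℝ → ℝ)
    (hh : ContDiff ℝ 2 (fun p : ℝ × ℝ × ℝ => h p.1 p.2.1 p.2.2))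
    (hu : ContDiff ℝ 2 (fun p : ℝ × ℝ × ℝ => u p.1 p.2.1 p.2.2))
    (hv : ContDiff ℝ 2 (fun p : ℝ × ℝ × ℝ => v p.1 p.2.1 p.2.2))
    (φ q r : ℝ → ℝ → ℝ → ℝ)
    (hφ : φ = fun t x y => g * (h t x y + b x y))
    (hq : q = fun t x y => η * (px φ t x y - ω * v t x y))
    (hr : r = fun t x y => ξ * (py φ t x y + ω * u t x y))
    (mass : ∀ t x y,
      pt h t x y
      + px (fun t x y => h t x y * u t x y - q t x y) t x y
      + py (fun t x y => h t x y * v t x y - r t x y) t x y = 0)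
    (momx : ∀ t x y,
      pt (fun t x y => h t x y * u t x y) t x y
      + px (fun t x y => (h t x y * u t x y - q t x y) * u t x y) t x y
      + py (fun t x y => (h t x y * v t x y - r t x y) * u t x y) t x y
      + h t x y * px φ t x y = ω * (h t x y * v t x y - r t x y))
    (momy : ∀ t x y,
      pt (fun t x y => h t x y * v t x y) t x y
      + px (fun t x y => (h t x y * u t x y - q t x y) * v t x y) t x y
      + py (fun t x y => (h t x y * v t x y - r t x y) * v t x y) t x y
      + h t x y * py φ t x y = -(ω * (h t x y * u t x y - q t x y)))
    (E : ℝ → ℝ → ℝ → ℝ)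
    (hE : E = fun t x y =>
      (1/2) * g * h t x y ^ 2 + g * b x y * h t x y
      + (1/2) * h t x y * (u t x y ^ 2 + v t x y ^ 2)) :
    ∀ t x y,
      (pt E t x y
        + px (fun t x y =>
            (φ t x y + (u t x y ^ 2 + v t x y ^ 2) / 2)
              * (h t x y * u t x y - q t x y)) t x y
        + py (fun t x y =>
            (φ t x y + (u t x y ^ 2 + v t x y ^ 2) / 2)
              * (h t x y * v t x y - r t x y)) t x y
        = - η * (px φ t x y - ω * v t x y) ^ 2
          - ξ * (py φ t x y + ω * u t x y) ^ 2)
      ∧ - η * (px φ t x y - ω * v t x y) ^ 2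
          - ξ * (py φ t x y + ω * u t x y) ^ 2 ≤ 0 := by
  have hφ2 : ContDiff ℝ 2 (fun p : ℝ × ℝ × ℝ => φ p.1 p.2.1 p.2.2) := by
    have hb' : ContDiff ℝ 2 (fun p : ℝ × ℝ × ℝ => b p.2.1 p.2.2) := hb.comp contDiff_snd
    rw [hφ]
    exact contDiff_const.mul (hh.add hb')
  intro t x y
  have hqsq := mul_nonneg hη.le (sq_nonneg (px φ t x y - ω * v t x y))
  have hrsq := mul_nonneg hξ.le (sq_nonneg (py φ t x y + ω * u t x y))
  refine ⟨?_, by linarith⟩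
  have two : (2 : WithTop ℕ∞) ≠ 0 := two_ne_zero
  have ht := (hh.slice_t x y).differentiable two t
  have ut := (hu.slice_t x y).differentiable two t
  have vt := (hv.slice_t x y).differentiable two t
  have hx := (hh.slice_x t y).differentiable two x
  have ux := (hu.slice_x t y).differentiable two x
  have vx := (hv.slice_x t y).differentiable two x
  have φx := (hφ2.slice_x t y).differentiable two x
  have hy := (hh.slice_y t x).differentiable two y
  have uy := (hu.slice_y t x).differentiable two y
  have vy := (hv.slice_y t x).differentiable two y
  have φy := (hφ2.slice_y t x).differentiable two y
  have qx : DifferentiableAt ℝ (fun s => q t s y) x := by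
    rw [hq]
    exact ((differentiable_px_slice hφ2 t y x).sub (vx.const_mul ω)).const_mul η
  have ry : DifferentiableAt ℝ (fun s => r t x s) y := by
    rw [hr]
    exact ((differentiable_py_slice hφ2 t x y).add (uy.const_mul ω)).const_mul ξ
  have mx : DifferentiableAt ℝ (fun s => h t s y * u t s y - q t s y) x := (hx.mul ux).sub qx
  have my : DifferentiableAt ℝ (fun s => h t x s * v t x s - r t x s) y := (hy.mul vy).sub ry
  have hqt : q t x y = η * (px φ t x y - ω * v t x y) := by rw [hq]
  have hrt : r t x y = ξ * (py φ t x y + ω * u t x y) := by rw [hr]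
  have hφt : φ t x y = g * (h t x y + b x y) := by rw [hφ]
  have mass' := mass t x y
  have momx' := momx t x y
  have momy' := momy t x y
  rw [hE]
  simp only [pt, px, py] at mass' momx' momy' hqt hrt ⊢
  rw [deriv_fun_mul ht ut, deriv_fun_mul mx ux, deriv_fun_mul my uy] at momx'
  rw [deriv_fun_mul ht vt, deriv_fun_mul mx vx, deriv_fun_mul my vy] at momy'
  rw [deriv_energy g (b x y) ht ut vt, deriv_energy_flux φx ux vx mx,
    deriv_energy_flux φy uy vy my, ← hφt]
  linear_combination (φ t x y - (u t x y ^ 2 + v t x y ^ 2) / 2) * mass'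
    + u t x y * momx' + v t x y * momy'
    - (deriv (fun s => φ t s y) x - ω * v t x y) * hqt
    - (deriv (fun s => φ t x s) y + ω * u t x y) * hrt
end

section
/- Suppose the grid functions hⁿ, hⁿ⁺¹, uⁿ, uⁿ⁺¹, vⁿ, vⁿ⁺¹, b, qⁿ⁺¹, rⁿ⁺¹ together with constants g, ω ∈ ℝ and Δt > 0 satisfy the finite volume scheme (mass and both momentum updates). Then the discrete total momentum balances hold: Σ_{i,j} Δx Δy hⁿ⁺¹_{i,j} uⁿ⁺¹_{i,j} = Σ_{i,j} Δx Δy hⁿ_{i,j} uⁿ_{i,j} − Δt Σ_{i,j} Δx Δy g hⁿ⁺¹_{i,j} ∂x b_{i,j} + Δt Σ_{i,j} Δx Δy (ω hⁿ⁺¹_{i,j} vⁿ_{i,j} − ω rⁿ⁺¹_{i,j}), and Σ_{i,j} Δx Δy hⁿ⁺¹_{i,j} vⁿ⁺¹_{i,j} = Σ_{i,j} Δx Δy hⁿ_{i,j} vⁿ_{i,j} − Δt Σ_{i,j} Δx Δy g hⁿ⁺¹_{i,j} ∂y b_{i,j} + Δt Σ_{i,j} Δx Δy (−ω hⁿ⁺¹_{i,j}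 uⁿ_{i,j} + ω qⁿ⁺¹_{i,j}). -/
/-- Cell indices of a uniform periodic grid with `Nx × Ny` cells. -/
abbrev Idx (Nx Ny : ℕ) := ZMod Nx × ZMod Ny

/-- A grid function on a uniform periodic grid with `Nx × Ny` cells. -/
abbrev Grid (Nx Ny : ℕ) := Idx Nx Ny → ℝ

variable {Nx Ny : ℕ}

/-- Shift the index one cell in the positive `x` direction. -/
def shXp (p : Idx Nx Ny) : Idx Nx Ny := (p.1 + 1, p.2)

/-- Shift the index one cell in the negative `x` direction. -/
def shXm (p : Idx Nx Ny) : Idx Nx Ny := (p.1 - 1, p.2)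

/-- Shift the index one cell in the positive `y` direction. -/
def shYp (p : Idx Nx Ny) : Idx Nx Ny := (p.1, p.2 + 1)

/-- Shift the index one cell in the negative `y` direction. -/
def shYm (p : Idx Nx Ny) : Idx Nx Ny := (p.1, p.2 - 1)

/-- Central discrete derivative in `x`: `(z_{i+1,j} − z_{i−1,j})/(2Δx)`. -/
noncomputable def dX (Δx : ℝ) (z : Grid Nx Ny) : Grid Nx Ny :=
  fun p => (z (shXp p) - z (shXm p)) / (2 * Δx)

/-- Central discrete derivative in `y`: `(z_{i,j+1} − z_{i,j−1})/(2Δy)`. -/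
noncomputable def dY (Δy : ℝ) (z : Grid Nx Ny) : Grid Nx Ny :=
  fun p => (z (shYp p) - z (shYm p)) / (2 * Δy)

/-- Average of a grid function at the vertical edge `(i+1/2, j)`. -/
noncomputable def avgX (z : Grid Nx Ny) : Grid Nx Ny := fun p => (z p + z (shXp p)) / 2

/-- Average of a grid function at the horizontal edge `(i, j+1/2)`. -/
noncomputable def avgY (z : Grid Nx Ny) : Grid Nx Ny := fun p => (z p + z (shYp p)) / 2

/-- Numerical mass flux `F^{n+1}_{i+1/2,j} = {{h^{n+1}u^n}}_{i+1/2,j} − {{q^{n+1}}}_{i+1/2,j}`. -/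
noncomputable def fluxF (h1 u0 q1 : Grid Nx Ny) : Grid Nx Ny :=
  fun p => avgX (fun s => h1 s * u0 s) p - avgX q1 p

/-- Numerical mass flux `G^{n+1}_{i,j+1/2} = {{h^{n+1}v^n}}_{i,j+1/2} − {{r^{n+1}}}_{i,j+1/2}`. -/
noncomputable def fluxG (h1 v0 r1 : Grid Nx Ny) : Grid Nx Ny :=
  fun p => avgY (fun s => h1 s * v0 s) p - avgY r1 p

/-- Upwind edge value at a vertical edge with respect to the flux `F`. -/
noncomputable def upX (F w : Grid Nx Ny) : Grid Nx Ny :=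
  fun p => if 0 ≤ F p then w p else w (shXp p)

/-- Upwind edge value at a horizontal edge with respect to the flux `G`. -/
noncomputable def upY (G w : Grid Nx Ny) : Grid Nx Ny :=
  fun p => if 0 ≤ G p then w p else w (shYp p)

/-- The semi-implicit finite volume scheme for the rotating shallow water system:
mass balance and both momentum balances, relating the solution `(h0, u0, v0)` at
time level `n` to the solution `(h1, u1, v1)` at time level `n+1`, with bottom
topography `b` and stabilisation terms `q1`, `r1`. -/
def Scheme (Δx Δy Δt g ω : ℝ) (h0 h1 u0 u1 v0 v1 b q1 r1 : Grid Nx Ny) : Prop :=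
  (∀ p : Idx Nx Ny,
    (h1 p - h0 p) / Δt
      + (fluxF h1 u0 q1 p - fluxF h1 u0 q1 (shXm p)) / Δx
      + (fluxG h1 v0 r1 p - fluxG h1 v0 r1 (shYm p)) / Δy = 0) ∧
  (∀ p : Idx Nx Ny,
    (h1 p * u1 p - h0 p * u0 p) / Δt
      + (fluxF h1 u0 q1 p * upX (fluxF h1 u0 q1) u0 p
          - fluxF h1 u0 q1 (shXm p) * upX (fluxF h1 u0 q1) u0 (shXm p)) / Δx
      + (fluxG h1 v0 r1 p * upY (fluxG h1 v0 r1) u0 p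
          - fluxG h1 v0 r1 (shYm p) * upY (fluxG h1 v0 r1) u0 (shYm p)) / Δy
      + h1 p * dX Δx (fun s => g * (h1 s + b s)) p
      = ω * h1 p * v0 p - ω * r1 p) ∧
  (∀ p : Idx Nx Ny,
    (h1 p * v1 p - h0 p * v0 p) / Δt
      + (fluxF h1 u0 q1 p * upX (fluxF h1 u0 q1) v0 p
          - fluxF h1 u0 q1 (shXm p) * upX (fluxF h1 u0 q1) v0 (shXm p)) / Δx
      + (fluxG h1 v0 r1 p * upY (fluxG h1 v0 r1) v0 p
          - fluxG h1 v0 r1 (shYm p) * upY (fluxG h1 v0 r1) v0 (shYm p)) / Δy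
      + h1 p * dY Δy (fun s => g * (h1 s + b s)) p
      = -(ω * h1 p * u0 p) + ω * q1 p)

/-- Sums over the periodic grid are invariant under the shift in the negative `x` direction. -/
theorem sum_shXm [NeZero Nx] [NeZero Ny] (f : Grid Nx Ny) :
    ∑ p, f (shXm p) = ∑ p, f p :=
  Equiv.sum_comp ((Equiv.subRight (1 : ZMod Nx)).prodCongr (Equiv.refl (ZMod Ny))) f

/-- Sums over the periodic grid are invariant under the shift in the negative `y` direction. -/
theorem sum_shYm [NeZero Nx] [NeZero Ny] (f : Grid Nx Ny) :
    ∑ p, f (shYm p) = ∑ p, f p :=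
  Equiv.sum_comp ((Equiv.refl (ZMod Nx)).prodCongr (Equiv.subRight (1 : ZMod Ny))) f

theorem shXp_shXm (p : Idx Nx Ny) : shXp (shXm p) = p := by
  simp [shXp, shXm]

theorem shYp_shYm (p : Idx Nx Ny) : shYp (shYm p) = p := by
  simp [shYp, shYm]

/-- The pressure term in `x` is the topography term plus a discrete divergence. -/
theorem mul_dX_pressure (Δx g : ℝ) (h b : Grid Nx Ny) (p : Idx Nx Ny) :
    h p * dX Δx (fun s => g * (h s + b s)) p = g * h p * dX Δx b p
      + (g / 2 * (h p * h (shXp p)) - g / 2 * (h (shXm p) * h (shXp (shXm p)))) / Δx := by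
  rw [shXp_shXm]
  simp only [dX, div_eq_mul_inv, mul_inv]
  ring

/-- The pressure term in `y` is the topography term plus a discrete divergence. -/
theorem mul_dY_pressure (Δy g : ℝ) (h b : Grid Nx Ny) (p : Idx Nx Ny) :
    h p * dY Δy (fun s => g * (h s + b s)) p = g * h p * dY Δy b p
      + (g / 2 * (h p * h (shYp p)) - g / 2 * (h (shYm p) * h (shYp (shYm p)))) / Δy := by
  rw [shYp_shYm]
  simp only [dY, div_eq_mul_inv, mul_inv]
  ring

/-- A cellwise balance law with fluxes `A`, `B` and sources `t`, `s` yields the balance of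
the totals over the periodic grid. -/
theorem sum_balance [NeZero Nx] [NeZero Ny] {Δx Δy Δt : ℝ}
    (hΔx : Δx ≠ 0) (hΔy : Δy ≠ 0) (hΔt : Δt ≠ 0) (m0 m1 A B t s : Grid Nx Ny)
    (hbal : ∀ p, (m1 p - m0 p) / Δt + (A p - A (shXm p)) / Δx + (B p - B (shYm p)) / Δy + t p
      = s p) :
    ∑ p, Δx * Δy * m1 p = ∑ p, Δx * Δy * m0 p - Δt * ∑ p, Δx * Δy * t p
      + Δt * ∑ p, Δx * Δy * s p := by
  have hcell : ∀ p, Δx * Δy * m1 p = Δx * Δy * m0 p - Δt * (Δx * Δy * t p)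
      + Δt * (Δx * Δy * s p) - Δt * Δy * (A p - A (shXm p))
      - Δt * Δx * (B p - B (shYm p)) := by
    intro p
    rw [← hbal p]
    field_simp
    ring
  rw [Finset.sum_congr rfl fun p _ => hcell p]
  simp only [Finset.sum_add_distrib, Finset.sum_sub_distrib, ← Finset.mul_sum, sum_shXm,
    sum_shYm]
  ring

/-- Discrete balance of the total momentum for the finite volume scheme. -/
theorem stmt_5 (Nx Ny : ℕ) [NeZero Nx] [NeZero Ny]
    (Δx Δy Δt g ω : ℝ) (hΔx : 0 < Δx) (hΔy : 0 < Δy) (hΔt : 0 < Δt)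
    (h0 h1 u0 u1 v0 v1 b q1 r1 : Grid Nx Ny)
    (hs : Scheme Δx Δy Δt g ω h0 h1 u0 u1 v0 v1 b q1 r1) :
    (∑ p : Idx Nx Ny, Δx * Δy * (h1 p * u1 p)
      = ∑ p : Idx Nx Ny, Δx * Δy * (h0 p * u0 p)
        - Δt * ∑ p : Idx Nx Ny, Δx * Δy * (g * h1 p * dX Δx b p)
        + Δt * ∑ p : Idx Nx Ny, Δx * Δy * (ω * h1 p * v0 p - ω * r1 p)) ∧
    (∑ p : Idx Nx Ny, Δx * Δy * (h1 p * v1 p)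
      = ∑ p : Idx Nx Ny, Δx * Δy * (h0 p * v0 p)
        - Δt * ∑ p : Idx Nx Ny, Δx * Δy * (g * h1 p * dY Δy b p)
        + Δt * ∑ p : Idx Nx Ny, Δx * Δy * (-(ω * h1 p * u0 p) + ω * q1 p)) := by
  obtain ⟨-, hu, hv⟩ := hs
  constructor
  · refine sum_balance hΔx.ne' hΔy.ne' hΔt.ne' _ _
      (fun p => fluxF h1 u0 q1 p * upX (fluxF h1 u0 q1) u0 p + g / 2 * (h1 p * h1 (shXp p)))
      (fun p => fluxG h1 v0 r1 p * upY (fluxG h1 v0 r1) u0 p) _ _ fun p => ?_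
    rw [← hu p, mul_dX_pressure]
    ring
  · refine sum_balance hΔx.ne' hΔy.ne' hΔt.ne' _ _
      (fun p => fluxF h1 u0 q1 p * upX (fluxF h1 u0 q1) v0 p)
      (fun p => fluxG h1 v0 r1 p * upY (fluxG h1 v0 r1) v0 p + g / 2 * (h1 p * h1 (shYp p)))
      _ _ fun p => ?_
    rw [← hv p, mul_dY_pressure]
    ring
end

section
/- Suppose grid functions hⁿ, hⁿ⁺¹, uⁿ, vⁿ, b, qⁿ⁺¹, rⁿ⁺¹ and constants g ∈ ℝ, Δt > 0 satisfy the discrete mass balance (hⁿ⁺¹_{i,j} − hⁿ_{i,j})/Δt + ∂x(hⁿ⁺¹uⁿ)_{i,j} + ∂y(hⁿ⁺¹vⁿ)_{i,j} − ∂x qⁿ⁺¹_{i,j} − ∂y rⁿ⁺¹_{i,j} = 0 for every (i,j). Then, with φⁿ⁺¹ = g(hⁿ⁺¹ + b) and the discrete potential energies I^k_{i,j} = ½ g (h^k_{i,j})² + g b_{i,j} h^k_{i,j} for k = n, n+1, the discrete potential energy identity holds for every (i,j): (Iⁿ⁺¹_{i,j} − Iⁿ_{i,j})/Δt + φⁿ⁺¹_{i,j}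 (∂x(hⁿ⁺¹uⁿ)_{i,j} + ∂y(hⁿ⁺¹vⁿ)_{i,j}) + g (hⁿ⁺¹_{i,j} − hⁿ_{i,j})²/(2Δt) = φⁿ⁺¹_{i,j} (∂x qⁿ⁺¹_{i,j} + ∂y rⁿ⁺¹_{i,j}). -/
variable {Nx Ny : ℕ}

/-- Discrete potential energy identity for the semi-implicit mass balance. -/
theorem stmt_6 (Nx Ny : ℕ) [NeZero Nx] [NeZero Ny]
    (Δx Δy Δt g : ℝ) (hΔx : 0 < Δx) (hΔy : 0 < Δy) (hΔt : 0 < Δt)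
    (h0 h1 u0 v0 b q1 r1 : Grid Nx Ny)
    (mass : ∀ p : Idx Nx Ny,
      (h1 p - h0 p) / Δt
        + dX Δx (fun s => h1 s * u0 s) p + dY Δy (fun s => h1 s * v0 s) p
        - dX Δx q1 p - dY Δy r1 p = 0)
    (φ1 : Grid Nx Ny) (hφ1 : φ1 = fun p => g * (h1 p + b p))
    (I0 I1 : Grid Nx Ny)
    (hI0 : I0 = fun p => (1/2) * g * (h0 p) ^ 2 + g * b p * h0 p)
    (hI1 : I1 = fun p => (1/2) * g * (h1 p) ^ 2 + g * b p * h1 p) :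
    ∀ p : Idx Nx Ny,
      (I1 p - I0 p) / Δt
        + φ1 p * (dX Δx (fun s => h1 s * u0 s) p + dY Δy (fun s => h1 s * v0 s) p)
        + g * (h1 p - h0 p) ^ 2 / (2 * Δt)
      = φ1 p * (dX Δx q1 p + dY Δy r1 p) := by
  intro p
  subst hφ1 hI0 hI1
  linear_combination g * (h1 p + b p) * mass p
end

section
/- Suppose the grid functions hⁿ, hⁿ⁺¹, uⁿ, uⁿ⁺¹, vⁿ, vⁿ⁺¹, b, qⁿ⁺¹, rⁿ⁺¹ together with constants g, ω ∈ ℝ and Δt > 0 satisfy the finite volume scheme (mass and both momentum updates). Then for every (i,j) the discrete kinetic energy identity holds: (Kⁿ⁺¹_{i,j} − Kⁿ_{i,j})/Δt + (1/(2Δx))[F^{n+1}_{i+1/2,j}((u^n_{i+1/2,j})²+(v^n_{i+1/2,j})²) − F^{n+1}_{i−1/2,j}((u^n_{i−1/2,j})²+(v^n_{i−1/2,j})²)] + (1/(2Δy))[G^{n+1}_{i,j+1/2}((u^n_{i,j+1/2})²+(v^n_{i,j+1/2})²) − G^{n+1}_{i,j−1/2}((u^n_{i,j−1/2})²+(v^n_{i,j−1/2})²)]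 + hⁿ⁺¹_{i,j}uⁿ_{i,j}∂xφⁿ⁺¹_{i,j} + hⁿ⁺¹_{i,j}vⁿ_{i,j}∂yφⁿ⁺¹_{i,j} = ω vⁿ_{i,j} qⁿ⁺¹_{i,j} − ω uⁿ_{i,j} rⁿ⁺¹_{i,j} + R^{n+1}_{i,j}, where K^k_{i,j} = ½ h^k_{i,j}((u^k_{i,j})² + (v^k_{i,j})²) and R^{n+1}_{i,j} = (hⁿ⁺¹_{i,j}/(2Δt))[(uⁿ⁺¹_{i,j}−uⁿ_{i,j})² + (vⁿ⁺¹_{i,j}−vⁿ_{i,j})²] + (1/(2Δx))[F^{n+1,−}_{i+1/2,j}([u]²_{i+1/2,j}+[v]²_{i+1/2,j}) − F^{n+1,+}_{i−1/2,j}([u]²_{i−1/2,j}+[v]²_{i−1/2,j})] + (1/(2Δy))[G^{n+1,−}_{i,j+1/2}([u]²_{i,j+1/2}+[v]²_{i,j+1/2}) − G^{n+1,+}_{i,j−1/2}([u]²_{i,j−1/2}+[v]²_{i,j−1/2})], with jumps taken of uⁿ, vⁿ and a⁺ = max(a,0), a⁻ = min(a,0). -/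
variable {Nx Ny : ℕ}

/-- Jump of a grid function across the vertical edge `(i+1/2, j)`. -/
def jX (z : Grid Nx Ny) : Grid Nx Ny := fun p => z (shXp p) - z p

/-- Jump of a grid function across the horizontal edge `(i, j+1/2)`. -/
def jY (z : Grid Nx Ny) : Grid Nx Ny := fun p => z (shYp p) - z p

/-- The remainder term `R^{n+1}_{i,j}` in the discrete kinetic energy identity;
here `F`, `G` are the numerical mass fluxes, `a⁺ = max a 0` and `a⁻ = min a 0`. -/
noncomputable def Rterm (Δx Δy Δt : ℝ) (h1 u0 u1 v0 v1 F G : Grid Nx Ny) :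
    Grid Nx Ny := fun p =>
  h1 p / (2 * Δt) * ((u1 p - u0 p) ^ 2 + (v1 p - v0 p) ^ 2)
  + (1 / (2 * Δx)) * (min (F p) 0 * ((jX u0 p) ^ 2 + (jX v0 p) ^ 2)
      - max (F (shXm p)) 0 * ((jX u0 (shXm p)) ^ 2 + (jX v0 (shXm p)) ^ 2))
  + (1 / (2 * Δy)) * (min (G p) 0 * ((jY u0 p) ^ 2 + (jY v0 p) ^ 2)
      - max (G (shYm p)) 0 * ((jY u0 (shYm p)) ^ 2 + (jY v0 (shYm p)) ^ 2))

/-- Upwinding at an outgoing edge: only a negative flux produces a deviation from the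
cell value `a`. -/
theorem flux_mul_upwind_left (f a c : ℝ) :
    f * (if 0 ≤ f then a else c) * a - f * a ^ 2 / 2
      = f * (if 0 ≤ f then a else c) ^ 2 / 2 - min f 0 * (c - a) ^ 2 / 2 := by
  split_ifs with hf
  · rw [min_eq_right hf]; ring
  · rw [min_eq_left (not_le.mp hf).le]; ring

/-- Upwinding at an incoming edge: only a positive flux produces a deviation from the
cell value `c`. -/
theorem flux_mul_upwind_right (f a c : ℝ) :
    f * (if 0 ≤ f then a else c) * c - f * c ^ 2 / 2
      = f * (if 0 ≤ f then a else c) ^ 2 / 2 - max f 0 * (c - a) ^ 2 / 2 := by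
  split_ifs with hf
  · rw [max_eq_left hf]; ring
  · rw [max_eq_right (not_le.mp hf).le]; ring

theorem fluxX_mul_upX (F w : Grid Nx Ny) (p : Idx Nx Ny) :
    F p * upX F w p * w p - F p * w p ^ 2 / 2
      = F p * upX F w p ^ 2 / 2 - min (F p) 0 * jX w p ^ 2 / 2 :=
  flux_mul_upwind_left _ _ _

theorem fluxX_mul_upX_shXm (F w : Grid Nx Ny) (p : Idx Nx Ny) :
    F (shXm p) * upX F w (shXm p) * w p - F (shXm p) * w p ^ 2 / 2
      = F (shXm p) * upX F w (shXm p) ^ 2 / 2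
        - max (F (shXm p)) 0 * jX w (shXm p) ^ 2 / 2 := by
  simpa only [upX, jX, shXp_shXm] using
    flux_mul_upwind_right (F (shXm p)) (w (shXm p)) (w p)

theorem fluxY_mul_upY (G w : Grid Nx Ny) (p : Idx Nx Ny) :
    G p * upY G w p * w p - G p * w p ^ 2 / 2
      = G p * upY G w p ^ 2 / 2 - min (G p) 0 * jY w p ^ 2 / 2 :=
  flux_mul_upwind_left _ _ _

theorem fluxY_mul_upY_shYm (G w : Grid Nx Ny) (p : Idx Nx Ny) :
    G (shYm p) * upY G w (shYm p) * w p - G (shYm p) * w p ^ 2 / 2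
      = G (shYm p) * upY G w (shYm p) ^ 2 / 2
        - max (G (shYm p)) 0 * jY w (shYm p) ^ 2 / 2 := by
  simpa only [upY, jY, shYp_shYm] using
    flux_mul_upwind_right (G (shYm p)) (w (shYm p)) (w p)

/-- Discrete kinetic energy identity for the finite volume scheme. -/
theorem stmt_7 (Nx Ny : ℕ) [NeZero Nx] [NeZero Ny]
    (Δx Δy Δt g ω : ℝ) (hΔx : 0 < Δx) (hΔy : 0 < Δy) (hΔt : 0 < Δt)
    (h0 h1 u0 u1 v0 v1 b q1 r1 : Grid Nx Ny)
    (hs : Scheme Δx Δy Δt g ω h0 h1 u0 u1 v0 v1 b q1 r1)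
    (φ1 : Grid Nx Ny) (hφ1 : φ1 = fun p => g * (h1 p + b p))
    (F G : Grid Nx Ny) (hF : F = fluxF h1 u0 q1) (hG : G = fluxG h1 v0 r1)
    (K0 K1 : Grid Nx Ny)
    (hK0 : K0 = fun p => (1/2) * h0 p * ((u0 p) ^ 2 + (v0 p) ^ 2))
    (hK1 : K1 = fun p => (1/2) * h1 p * ((u1 p) ^ 2 + (v1 p) ^ 2)) :
    ∀ p : Idx Nx Ny,
      (K1 p - K0 p) / Δt
      + (1 / (2 * Δx)) *
          (F p * ((upX F u0 p) ^ 2 + (upX F v0 p) ^ 2)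
            - F (shXm p) * ((upX F u0 (shXm p)) ^ 2 + (upX F v0 (shXm p)) ^ 2))
      + (1 / (2 * Δy)) *
          (G p * ((upY G u0 p) ^ 2 + (upY G v0 p) ^ 2)
            - G (shYm p) * ((upY G u0 (shYm p)) ^ 2 + (upY G v0 (shYm p)) ^ 2))
      + h1 p * u0 p * dX Δx φ1 p + h1 p * v0 p * dY Δy φ1 p
      = ω * v0 p * q1 p - ω * u0 p * r1 p
        + Rterm Δx Δy Δt h1 u0 u1 v0 v1 F G p := by
  subst hφ1 hK0 hK1
  intro p
  obtain ⟨mass, momU, momV⟩ := hs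
  have mass := mass p
  have momU := momU p
  have momV := momV p
  rw [← hF, ← hG] at mass momU momV
  simp only [Rterm]
  linear_combination u0 p * momU + v0 p * momV - (u0 p ^ 2 + v0 p ^ 2) / 2 * mass
    - (1 / Δx) * (fluxX_mul_upX F u0 p + fluxX_mul_upX F v0 p
        - fluxX_mul_upX_shXm F u0 p - fluxX_mul_upX_shXm F v0 p)
    - (1 / Δy) * (fluxY_mul_upY G u0 p + fluxY_mul_upY G v0 p
        - fluxY_mul_upY_shYm G u0 p - fluxY_mul_upY_shYm G v0 p)
end

section
/- Suppose the grid functions hⁿ, hⁿ⁺¹, uⁿ, uⁿ⁺¹, vⁿ, vⁿ⁺¹, b, qⁿ⁺¹, rⁿ⁺¹ together with constants g, ω ∈ ℝ and Δt > 0 satisfy the finite volume scheme (mass and both momentum updates), that hⁿ⁺¹_{i,j} > 0 for all (i,j), and that the CFL-type condition 1 + (3Δt/hⁿ⁺¹_{i,j})·[(F^{n+1,−}_{i+1/2,j} − F^{n+1,+}_{i−1/2,j})/Δx + (G^{n+1,−}_{i,j+1/2} − G^{n+1,+}_{i,j−1/2})/Δy] ≥ 0 holds for all (i,j), where a⁺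 = max(a,0), a⁻ = min(a,0). Then the kinetic energy remainder R^{n+1}_{i,j} := (hⁿ⁺¹_{i,j}/(2Δt))[(uⁿ⁺¹_{i,j}−uⁿ_{i,j})² + (vⁿ⁺¹_{i,j}−vⁿ_{i,j})²] + (1/(2Δx))[F^{n+1,−}_{i+1/2,j}([uⁿ]²_{i+1/2,j}+[vⁿ]²_{i+1/2,j}) − F^{n+1,+}_{i−1/2,j}([uⁿ]²_{i−1/2,j}+[vⁿ]²_{i−1/2,j})] + (1/(2Δy))[G^{n+1,−}_{i,j+1/2}([uⁿ]²_{i,j+1/2}+[vⁿ]²_{i,j+1/2}) − G^{n+1,+}_{i,j−1/2}([uⁿ]²_{i,j−1/2}+[vⁿ]²_{i,j−1/2})] satisfies, for every (i,j), R^{n+1}_{i,j} ≤ (3/2)Δt hⁿ⁺¹_{i,j}[(∂xφⁿ⁺¹_{i,j} − ω vⁿ_{i,j})² + (∂yφⁿ⁺¹_{i,j} + ω uⁿ_{i,j})²] + (3ω²Δt/(2hⁿ⁺¹_{i,j}))[(qⁿ⁺¹_{i,j})² + (rⁿ⁺¹_{i,j})²]. -/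
variable {Nx Ny : ℕ}

theorem mul_upX_eq_left (F w : Grid Nx Ny) (p : Idx Nx Ny) :
    F p * upX F w p = F p * w p + min (F p) 0 * jX w p := by
  unfold upX jX
  split_ifs with h
  · rw [min_eq_right h]; ring
  · rw [min_eq_left (not_le.mp h).le]; ring

theorem mul_upY_eq_left (G w : Grid Nx Ny) (p : Idx Nx Ny) :
    G p * upY G w p = G p * w p + min (G p) 0 * jY w p := by
  unfold upY jY
  split_ifs with h
  · rw [min_eq_right h]; ring
  · rw [min_eq_left (not_le.mp h).le]; ring

theorem mul_upX_eq_right (F w : Grid Nx Ny) (p : Idx Nx Ny) :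
    F (shXm p) * upX F w (shXm p)
      = F (shXm p) * w p - max (F (shXm p)) 0 * jX w (shXm p) := by
  have hmax := min_add_max (F (shXm p)) 0
  rw [mul_upX_eq_left]
  simp only [jX, shXp_shXm]
  linear_combination (w p - w (shXm p)) * hmax

theorem mul_upY_eq_right (G w : Grid Nx Ny) (p : Idx Nx Ny) :
    G (shYm p) * upY G w (shYm p)
      = G (shYm p) * w p - max (G (shYm p)) 0 * jY w (shYm p) := by
  have hmax := min_add_max (G (shYm p)) 0
  rw [mul_upY_eq_left]
  simp only [jY, shYp_shYm]
  linear_combination (w p - w (shYm p)) * hmax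

/-- Combining a mass balance with a momentum balance for the velocity component `w` gives the
non-conservative upwind update of `w`. -/
theorem velocity_update {Δx Δy Δt : ℝ} (hΔt : 0 < Δt) {h0 h1 w0 w1 F G : Grid Nx Ny}
    {p : Idx Nx Ny} {P s : ℝ}
    (mass : (h1 p - h0 p) / Δt + (F p - F (shXm p)) / Δx + (G p - G (shYm p)) / Δy = 0)
    (momentum : (h1 p * w1 p - h0 p * w0 p) / Δt
      + (F p * upX F w0 p - F (shXm p) * upX F w0 (shXm p)) / Δx
      + (G p * upY G w0 p - G (shYm p) * upY G w0 (shYm p)) / Δy + h1 p * P + s = 0) :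
    h1 p * (w1 p - w0 p)
      = -(Δt * (min (F p) 0 / Δx * jX w0 p + max (F (shXm p)) 0 / Δx * jX w0 (shXm p)
          + min (G p) 0 / Δy * jY w0 p + max (G (shYm p)) 0 / Δy * jY w0 (shYm p)
          + h1 p * P + s)) := by
  rw [mul_upX_eq_left, mul_upX_eq_right, mul_upY_eq_left, mul_upY_eq_right] at momentum
  have key : h1 p * (w1 p - w0 p) / Δt
      = -(min (F p) 0 / Δx * jX w0 p + max (F (shXm p)) 0 / Δx * jX w0 (shXm p)
          + min (G p) 0 / Δy * jY w0 p + max (G (shYm p)) 0 / Δy * jY w0 (shYm p)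
          + h1 p * P + s) := by
    linear_combination momentum - w0 p * mass
  rw [div_eq_iff hΔt.ne'] at key
  linear_combination key

/-- Weighted Cauchy–Schwarz inequality for four terms. -/
theorem sq_weighted_sum_four_le {a b c d : ℝ} (ha : 0 ≤ a) (hb : 0 ≤ b) (hc : 0 ≤ c)
    (hd : 0 ≤ d) (x y z w : ℝ) :
    (a * x + b * y + c * z + d * w) ^ 2
      ≤ (a + b + c + d) * (a * x ^ 2 + b * y ^ 2 + c * z ^ 2 + d * w ^ 2) := by
  nlinarith [mul_nonneg (mul_nonneg ha hb) (sq_nonneg (x - y)),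
    mul_nonneg (mul_nonneg ha hc) (sq_nonneg (x - z)),
    mul_nonneg (mul_nonneg ha hd) (sq_nonneg (x - w)),
    mul_nonneg (mul_nonneg hb hc) (sq_nonneg (y - z)),
    mul_nonneg (mul_nonneg hb hd) (sq_nonneg (y - w)),
    mul_nonneg (mul_nonneg hc hd) (sq_nonneg (z - w))]

/-- Kinetic energy production of one velocity component whose increment is `δ`, with nonpositive
weights `a`, `c` and nonnegative weights `b`, `d` controlled by the CFL condition. -/
theorem component_remainder_le {h Δt a b c d : ℝ} (hh : 0 < h) (hΔt : 0 < Δt) (ha : a ≤ 0)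
    (hb : 0 ≤ b) (hc : c ≤ 0) (hd : 0 ≤ d)
    (cfl : 0 ≤ 1 + 3 * Δt / h * (a - b + (c - d))) {x y z w P s δ : ℝ}
    (hδ : h * δ = -(Δt * (a * x + b * y + c * z + d * w + h * P + s))) :
    h / (2 * Δt) * δ ^ 2
        + 1 / 2 * (a * x ^ 2 - b * y ^ 2 + (c * z ^ 2 - d * w ^ 2))
      ≤ 3 / 2 * Δt * h * P ^ 2 + 3 * Δt / (2 * h) * s ^ 2 := by
  set A := a * x + b * y + c * z + d * w with hA
  set Q := -a * x ^ 2 + b * y ^ 2 + -c * z ^ 2 + d * w ^ 2 with hQ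
  have hQ0 : 0 ≤ Q := by
    have := neg_nonneg.mpr ha
    have := neg_nonneg.mpr hc
    positivity
  have hA2 : A ^ 2 ≤ (-a + b + -c + d) * Q := by
    have := sq_weighted_sum_four_le (neg_nonneg.mpr ha) hb (neg_nonneg.mpr hc) hd (-x) y (-z) w
    simpa [hA, hQ] using this
  have hsum : 3 * Δt / h * A ^ 2 ≤ Q := by
    have h1 : 3 * Δt / h * A ^ 2 ≤ 3 * Δt / h * ((-a + b + -c + d) * Q) := by gcongr
    nlinarith [mul_nonneg cfl hQ0]
  have hsq : (A + h * P + s) ^ 2 ≤ 3 * (A ^ 2 + (h * P) ^ 2 + s ^ 2) := by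
    nlinarith [sq_nonneg (A - h * P), sq_nonneg (A - s), sq_nonneg (h * P - s)]
  have hδ2 : h / (2 * Δt) * δ ^ 2 = Δt / (2 * h) * (A + h * P + s) ^ 2 := by
    have : δ = -(Δt * (A + h * P + s)) / h := by rw [eq_div_iff hh.ne', ← hδ]; ring
    rw [this]
    field_simp
  have hbound : Δt / (2 * h) * (A + h * P + s) ^ 2
      ≤ Δt / (2 * h) * (3 * (A ^ 2 + (h * P) ^ 2 + s ^ 2)) := by gcongr
  have hexpand : Δt / (2 * h) * (3 * (A ^ 2 + (h * P) ^ 2 + s ^ 2))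
      = 1 / 2 * (3 * Δt / h * A ^ 2) + 3 / 2 * Δt * h * P ^ 2 + 3 * Δt / (2 * h) * s ^ 2 := by
    field_simp
  rw [hδ2]
  linarith

/-- Bound on the kinetic energy remainder under the CFL-type condition. -/
theorem stmt_8 (Nx Ny : ℕ) [NeZero Nx] [NeZero Ny]
    (Δx Δy Δt g ω : ℝ) (hΔx : 0 < Δx) (hΔy : 0 < Δy) (hΔt : 0 < Δt)
    (h0 h1 u0 u1 v0 v1 b q1 r1 : Grid Nx Ny)
    (hs : Scheme Δx Δy Δt g ω h0 h1 u0 u1 v0 v1 b q1 r1)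
    (hpos : ∀ p : Idx Nx Ny, 0 < h1 p)
    (φ1 : Grid Nx Ny) (hφ1 : φ1 = fun p => g * (h1 p + b p))
    (F G : Grid Nx Ny) (hF : F = fluxF h1 u0 q1) (hG : G = fluxG h1 v0 r1)
    (cfl : ∀ p : Idx Nx Ny,
      0 ≤ 1 + (3 * Δt / h1 p) *
        ((min (F p) 0 - max (F (shXm p)) 0) / Δx
          + (min (G p) 0 - max (G (shYm p)) 0) / Δy)) :
    ∀ p : Idx Nx Ny,
      Rterm Δx Δy Δt h1 u0 u1 v0 v1 F G p
        ≤ (3/2) * Δt * h1 p *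
            ((dX Δx φ1 p - ω * v0 p) ^ 2 + (dY Δy φ1 p + ω * u0 p) ^ 2)
          + (3 * ω ^ 2 * Δt / (2 * h1 p)) * ((q1 p) ^ 2 + (r1 p) ^ 2) := by
  subst hφ1
  obtain ⟨mass, momU, momV⟩ := hs
  rw [← hF, ← hG] at mass momU momV
  intro p
  have hu := velocity_update (w0 := u0) (w1 := u1)
    (P := dX Δx (fun s => g * (h1 s + b s)) p - ω * v0 p)
    (s := ω * r1 p) hΔt (mass p) (by linear_combination momU p)
  have hv := velocity_update (w0 := v0) (w1 := v1)
    (P := dY Δy (fun s => g * (h1 s + b s)) p + ω * u0 p)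
    (s := -(ω * q1 p)) hΔt (mass p) (by linear_combination momV p)
  have hcfl := cfl p
  rw [sub_div, sub_div] at hcfl
  have ha : min (F p) 0 / Δx ≤ 0 := div_nonpos_of_nonpos_of_nonneg (min_le_right _ _) hΔx.le
  have hb : 0 ≤ max (F (shXm p)) 0 / Δx := div_nonneg (le_max_right _ _) hΔx.le
  have hc : min (G p) 0 / Δy ≤ 0 := div_nonpos_of_nonpos_of_nonneg (min_le_right _ _) hΔy.le
  have hd : 0 ≤ max (G (shYm p)) 0 / Δy := div_nonneg (le_max_right _ _) hΔy.le
  have hRu := component_remainder_le (hpos p) hΔt ha hb hc hd hcfl hu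
  have hRv := component_remainder_le (hpos p) hΔt ha hb hc hd hcfl hv
  unfold Rterm
  refine le_trans (le_of_eq ?_) ((add_le_add hRu hRv).trans (le_of_eq ?_)) <;> ring
end

section
/- Let Nx, Ny ≥ 1, Δx, Δy, Δt > 0, g > 0, η > 0, ω ∈ ℝ, and let uⁿ, vⁿ be grid functions satisfying (Δt/Δx)|uⁿ_{i,j}| < 1/2 and (Δt/Δy)|vⁿ_{i,j}| < 1/2 for all (i,j). Then the linear map L on the space of grid functions defined by (Lφ)_{i,j} = φ_{i,j} − gηΔt²(∂x(∂xφ)_{i,j} + ∂y(∂yφ)_{i,j}) + Δt ∂x(φuⁿ)_{i,j} + Δt ∂y(φvⁿ)_{i,j} is bijective; in particular, for every grid function f the discrete elliptic problem Lφ = f has a unique grid-function solution φ. -/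
variable {Nx Ny : ℕ}

/-- The discrete linear elliptic operator arising from the semi-implicit mass
balance after substituting the stabilisation terms. -/
noncomputable def ellOp (Δx Δy Δt g η : ℝ) (u0 v0 : Grid Nx Ny) :
    Grid Nx Ny → Grid Nx Ny := fun φ p =>
  φ p - g * η * Δt ^ 2 * (dX Δx (dX Δx φ) p + dY Δy (dY Δy φ) p)
    + Δt * dX Δx (fun s => φ s * u0 s) p
    + Δt * dY Δy (fun s => φ s * v0 s) p

/-- Central differences along a permutation are skew-adjoint. -/
lemma sum_centralDiff_mul {ι : Type*} [Fintype ι] (σ : Equiv.Perm ι) (h : ℝ) (z w : ι → ℝ) :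
    ∑ p, (z (σ p) - z (σ.symm p)) / h * w p =
      -∑ p, z p * ((w (σ p) - w (σ.symm p)) / h) := by
  have forward : ∑ p, z (σ p) * w p = ∑ p, z p * w (σ.symm p) := by
    rw [← Equiv.sum_comp σ fun p => z p * w (σ.symm p)]
    simp
  have backward : ∑ p, z (σ.symm p) * w p = ∑ p, z p * w (σ p) := by
    rw [← Equiv.sum_comp σ.symm fun p => z p * w (σ p)]
    simp
  have expand_left : ∀ p, (z (σ p) - z (σ.symm p)) / h * w p =
      (z (σ p) * w p - z (σ.symm p) * w p) / h := fun p => by ring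
  have expand_right : ∀ p, z p * ((w (σ p) - w (σ.symm p)) / h) =
      (z p * w (σ p) - z p * w (σ.symm p)) / h := fun p => by ring
  simp only [expand_left, expand_right, ← Finset.sum_div, Finset.sum_sub_distrib,
    forward, backward]
  ring

/-- The product `a * x * (y - z) / 2` is controlled by squares when `|a| < 1 / 2`. -/
lemma mul_sub_le_sq {a : ℝ} (ha : |a| < 1 / 2) (x y z : ℝ) :
    a * x * (y - z) / 2 ≤ x ^ 2 / 4 + (y ^ 2 + z ^ 2) / 8 := by
  obtain ⟨h₁, h₂⟩ := abs_lt.mp ha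
  nlinarith [mul_nonneg (by linarith : 0 ≤ 1 / 2 + a) (sq_nonneg (x + y)),
    mul_nonneg (by linarith : 0 ≤ 1 / 2 - a) (sq_nonneg (x - y)),
    mul_nonneg (by linarith : 0 ≤ 1 / 2 + a) (sq_nonneg (x - z)),
    mul_nonneg (by linarith : 0 ≤ 1 / 2 - a) (sq_nonneg (x + z)), sq_nonneg x]

/-- The bound `mul_sub_le_sq` is strict for `x ≠ 0`. -/
lemma mul_sub_lt_sq {a : ℝ} (ha : |a| < 1 / 2) {x : ℝ} (hx : x ≠ 0) (y z : ℝ) :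
    a * x * (y - z) / 2 < x ^ 2 / 4 + (y ^ 2 + z ^ 2) / 8 := by
  have habs : |2 * a * (y - z)| ≤ |y - z| := by
    rw [abs_mul, abs_mul, abs_two]
    nlinarith [abs_nonneg (y - z)]
  have hsq : (2 * a * (y - z)) ^ 2 ≤ (y - z) ^ 2 := sq_le_sq.mpr habs
  refine lt_of_le_of_ne (mul_sub_le_sq ha x y z) fun heq => ?_
  have hx2 : 0 < x ^ 2 := by positivity
  have hyz : y + z = 0 := by
    nlinarith [sq_nonneg (x - a * (y - z)), sq_nonneg (y + z)]
  obtain rfl : z = -y := by linarith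
  have hxy : x = 2 * a * y := by nlinarith [sq_nonneg (x - 2 * a * y)]
  have hy : y ≠ 0 := by
    rintro rfl
    simp [hx] at hxy
  have hy2 : 0 < y ^ 2 := by positivity
  obtain ⟨h₁, h₂⟩ := abs_lt.mp ha
  subst hxy
  nlinarith [mul_pos (mul_pos (by linarith : 0 < 1 / 2 + a) (by linarith : 0 < 1 / 2 - a)) hy2]

/-- Under a CFL condition, the advection term is dominated by half of the squared norm. -/
lemma sum_advection_pos {ι : Type*} [Fintype ι] (σ : Equiv.Perm ι) {h τ : ℝ}
    (hh : 0 < h) (hτ : 0 < τ) (u φ : ι → ℝ) (hu : ∀ p, τ / h * |u p| < 1 / 2) (hφ : φ ≠ 0) :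
    0 < ∑ p, φ p ^ 2 / 2 +
      τ * ∑ p, (φ (σ p) * u (σ p) - φ (σ.symm p) * u (σ.symm p)) / (2 * h) * φ p := by
  rw [sum_centralDiff_mul σ (2 * h) fun p => φ p * u p]
  have ha : ∀ p, |τ / h * u p| < 1 / 2 := fun p => by
    rw [abs_mul, abs_of_pos (div_pos hτ hh)]
    exact hu p
  obtain ⟨q, hq⟩ := Function.ne_iff.mp hφ
  have hlt : ∑ p, τ / h * u p * φ p * (φ (σ p) - φ (σ.symm p)) / 2 <
      ∑ p, (φ p ^ 2 / 4 + (φ (σ p) ^ 2 + φ (σ.symm p) ^ 2) / 8) :=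
    Finset.sum_lt_sum (fun p _ => mul_sub_le_sq (ha p) _ _ _)
      ⟨q, Finset.mem_univ q, mul_sub_lt_sq (ha q) hq _ _⟩
  have hsum : ∑ p, (φ p ^ 2 / 4 + (φ (σ p) ^ 2 + φ (σ.symm p) ^ 2) / 8) =
      ∑ p, φ p ^ 2 / 2 := by
    simp only [Finset.sum_add_distrib, ← Finset.sum_div,
      Equiv.sum_comp σ fun p => φ p ^ 2, Equiv.sum_comp σ.symm fun p => φ p ^ 2]
    ring
  have hadv : ∑ p, τ / h * u p * φ p * (φ (σ p) - φ (σ.symm p)) / 2 =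
      τ * ∑ p, φ p * u p * ((φ (σ p) - φ (σ.symm p)) / (2 * h)) := by
    rw [Finset.mul_sum]
    refine Finset.sum_congr rfl fun p _ => ?_
    field_simp
  linarith

/-- The shift in the `x` direction as a permutation of the cells. -/
def shiftX (Nx Ny : ℕ) : Equiv.Perm (Idx Nx Ny) where
  toFun := shXp
  invFun := shXm
  left_inv p := by simp [shXp, shXm]
  right_inv p := by simp [shXp, shXm]

/-- The shift in the `y` direction as a permutation of the cells. -/
def shiftY (Nx Ny : ℕ) : Equiv.Perm (Idx Nx Ny) where
  toFun := shYp
  invFun := shYm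
  left_inv p := by simp [shYp, shYm]
  right_inv p := by simp [shYp, shYm]

lemma sum_dX_mul [NeZero Nx] [NeZero Ny] (Δx : ℝ) (z w : Grid Nx Ny) :
    ∑ p, dX Δx z p * w p = -∑ p, z p * dX Δx w p :=
  sum_centralDiff_mul (shiftX Nx Ny) (2 * Δx) z w

lemma sum_dY_mul [NeZero Nx] [NeZero Ny] (Δy : ℝ) (z w : Grid Nx Ny) :
    ∑ p, dY Δy z p * w p = -∑ p, z p * dY Δy w p :=
  sum_centralDiff_mul (shiftY Nx Ny) (2 * Δy) z w

/-- The discrete elliptic operator as a linear map. -/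
noncomputable def ellOpLinear (Δx Δy Δt g η : ℝ) (u0 v0 : Grid Nx Ny) :
    Grid Nx Ny →ₗ[ℝ] Grid Nx Ny where
  toFun := ellOp Δx Δy Δt g η u0 v0
  map_add' φ ψ := by
    funext p
    simp only [ellOp, dX, dY, Pi.add_apply]
    ring
  map_smul' c φ := by
    funext p
    simp only [ellOp, dX, dY, Pi.smul_apply, smul_eq_mul, RingHom.id_apply]
    ring

/-- Under the CFL conditions the discrete elliptic operator is positive definite. -/
lemma sum_ellOp_mul_self_pos [NeZero Nx] [NeZero Ny] {Δx Δy Δt g η : ℝ}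
    (hΔx : 0 < Δx) (hΔy : 0 < Δy) (hΔt : 0 < Δt) (hg : 0 < g) (hη : 0 < η)
    {u0 v0 : Grid Nx Ny}
    (hu : ∀ p, Δt / Δx * |u0 p| < 1 / 2) (hv : ∀ p, Δt / Δy * |v0 p| < 1 / 2)
    {φ : Grid Nx Ny} (hφ : φ ≠ 0) :
    0 < ∑ p, ellOp Δx Δy Δt g η u0 v0 φ p * φ p := by
  have advX : 0 < ∑ p, φ p ^ 2 / 2 + Δt * ∑ p, dX Δx (fun s => φ s * u0 s) p * φ p :=
    sum_advection_pos (shiftX Nx Ny) hΔx hΔt u0 φ hu hφ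
  have advY : 0 < ∑ p, φ p ^ 2 / 2 + Δt * ∑ p, dY Δy (fun s => φ s * v0 s) p * φ p :=
    sum_advection_pos (shiftY Nx Ny) hΔy hΔt v0 φ hv hφ
  have diffusion : 0 ≤ g * η * Δt ^ 2 *
      (∑ p, dX Δx φ p * dX Δx φ p + ∑ p, dY Δy φ p * dY Δy φ p) :=
    mul_nonneg (by positivity) <| add_nonneg
      (Finset.sum_nonneg fun p _ => mul_self_nonneg _)
      (Finset.sum_nonneg fun p _ => mul_self_nonneg _)
  have expand : ∑ p, ellOp Δx Δy Δt g η u0 v0 φ p * φ p =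
      ∑ p, φ p ^ 2 / 2 + ∑ p, φ p ^ 2 / 2
        - g * η * Δt ^ 2 *
          (∑ p, dX Δx (dX Δx φ) p * φ p + ∑ p, dY Δy (dY Δy φ) p * φ p)
        + Δt * ∑ p, dX Δx (fun s => φ s * u0 s) p * φ p
        + Δt * ∑ p, dY Δy (fun s => φ s * v0 s) p * φ p := by
    simp only [← Finset.sum_add_distrib, ← Finset.sum_sub_distrib, Finset.mul_sum]
    refine Finset.sum_congr rfl fun p _ => ?_
    simp only [ellOp]
    ring
  rw [expand, sum_dX_mul Δx (dX Δx φ), sum_dY_mul Δy (dY Δy φ)]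
  linarith

/-- Under the advective CFL conditions the discrete elliptic operator is
bijective; in particular the discrete elliptic problem has a unique solution. -/
theorem stmt_13 (Nx Ny : ℕ) [NeZero Nx] [NeZero Ny]
    (Δx Δy Δt g η ω : ℝ) (hΔx : 0 < Δx) (hΔy : 0 < Δy) (hΔt : 0 < Δt)
    (hg : 0 < g) (hη : 0 < η)
    (u0 v0 : Grid Nx Ny)
    (hu : ∀ p : Idx Nx Ny, Δt / Δx * |u0 p| < 1/2)
    (hv : ∀ p : Idx Nx Ny, Δt / Δy * |v0 p| < 1/2) :
    Function.Bijective (ellOp Δx Δy Δt g η u0 v0 : Grid Nx Ny → Grid Nx Ny)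
    ∧ ∀ f : Grid Nx Ny, ∃! φ : Grid Nx Ny, ellOp Δx Δy Δt g η u0 v0 φ = f := by
  have hinj : Function.Injective (ellOpLinear Δx Δy Δt g η u0 v0) := by
    refine (injective_iff_map_eq_zero _).mpr fun φ hker => ?_
    by_contra hφ
    have hpos := sum_ellOp_mul_self_pos hΔx hΔy hΔt hg hη hu hv hφ
    have hzero : ellOp Δx Δy Δt g η u0 v0 φ = 0 := hker
    simp [hzero] at hpos
  have hbij : Function.Bijective (ellOp Δx Δy Δt g η u0 v0) :=
    ⟨hinj, LinearMap.injective_iff_surjective.mp hinj⟩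
  exact ⟨hbij, hbij.existsUnique⟩
end

section
/- Let hⁿ, hⁿ⁺¹ > 0, Δt > 0, η > 0, ω ∈ ℝ and ζ ∈ (0,1) be real numbers with (3/4)hⁿ ≤ hⁿ⁺¹ ≤ (5/4)hⁿ. If η > (15/8)hⁿ and Δt² · 2ω²η² ≤ ζ · hⁿ · (η − (15/8)hⁿ), then η > (3/2)hⁿ⁺¹ and Δt² · 3ω²η² ≤ ζ · 2hⁿ⁺¹ · (η − (3/2)hⁿ⁺¹); that is, the explicit conditions on the old water height imply the (implicit) energy-stability conditions on the new water height. -/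
/-- The explicit conditions on the old water height imply the implicit
energy-stability conditions on the new water height, given the bounds
`(3/4)hⁿ ≤ hⁿ⁺¹ ≤ (5/4)hⁿ` guaranteed by the advective CFL condition. -/
theorem stmt_16 (h0 h1 Δt η ω ζ : ℝ)
    (hh0 : 0 < h0) (hh1 : 0 < h1) (hΔt : 0 < Δt) (hη : 0 < η)
    (hζ : ζ ∈ Set.Ioo (0:ℝ) 1)
    (hlow : (3/4) * h0 ≤ h1) (hhigh : h1 ≤ (5/4) * h0)
    (hηh : η > (15/8) * h0)
    (hts : Δt ^ 2 * (2 * ω ^ 2 * η ^ 2) ≤ ζ * h0 * (η - (15/8) * h0)) :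
    η > (3/2) * h1
    ∧ Δt ^ 2 * (3 * ω ^ 2 * η ^ 2) ≤ ζ * (2 * h1) * (η - (3/2) * h1) := by
  have hprod : (3/2) * h0 * (η - (15/8) * h0) ≤ 2 * h1 * (η - (3/2) * h1) :=
    mul_le_mul (by linarith) (by linarith) (by linarith) (by linarith)
  refine ⟨by linarith, ?_⟩
  calc Δt ^ 2 * (3 * ω ^ 2 * η ^ 2) = (3/2) * (Δt ^ 2 * (2 * ω ^ 2 * η ^ 2)) := by ring
    _ ≤ (3/2) * (ζ * h0 * (η - (15/8) * h0)) := by gcongr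
    _ = ζ * ((3/2) * h0 * (η - (15/8) * h0)) := by ring
    _ ≤ ζ * (2 * h1 * (η - (3/2) * h1)) := mul_le_mul_of_nonneg_left hprod hζ.1.le
    _ = ζ * (2 * h1) * (η - (3/2) * h1) := by ring
end
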